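/- The Dawson-weighted exponential kernel is not integrable at the origin of the density: ∫₀^∞ D₊(u/√2) du = ∞, and consequently for every τ > 0 the marginal horseshoe density is unbounded at zero: p_HS(x) → ∞ as x → 0⁺. -/

import Mathlib

open MeasureTheory Real Set

/-- The Dawson function `D₊(z) = exp(-z²) ∫₀^z exp(t²) dt`. -/
noncomputable def dawson (z : ℝ) : ℝ := Real.exp (-z ^ 2) * ∫ t in (0:ℝ)..z, Real.exp (t ^ 2)

/-- The marginal horseshoe density with global scale `τ`. -/
noncomputable def pHS (τ x : ℝ) : ℝ :=
  ∫ l in Set.Ioi (0:ℝ),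
    (Real.sqrt (2 * Real.pi))⁻¹ * (l * τ)⁻¹ * Real.exp (-x ^ 2 / (2 * l ^ 2 * τ ^ 2)) *
      ((2 / Real.pi) * (1 + l ^ 2)⁻¹)

/-- The Dawson function decays no faster than a multiple of `1 / z`. -/
lemma exp_neg_two_mul_inv_le_dawson {z : ℝ} (hz : 1 ≤ z) : Real.exp (-2) * z⁻¹ ≤ dawson z := by
  have hz0 : 0 < z := by linarith
  have hinv : z⁻¹ ≤ 1 := inv_le_one_of_one_le₀ hz
  have hinv0 : 0 < z⁻¹ := inv_pos.2 hz0
  have hmul : z * z⁻¹ = 1 := mul_inv_cancel₀ hz0.ne'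
  have hcont : Continuous fun t : ℝ => Real.exp (t ^ 2) := by fun_prop
  have hsub : ∫ t in (z - z⁻¹)..z, Real.exp (t ^ 2) ≤ ∫ t in (0:ℝ)..z, Real.exp (t ^ 2) :=
    intervalIntegral.integral_mono_interval (by linarith) (by linarith) le_rfl
      (Filter.Eventually.of_forall fun t => (Real.exp_pos _).le) (hcont.intervalIntegrable _ _)
  have hconst : ∫ _ in (z - z⁻¹)..z, Real.exp (z ^ 2 - 2) ≤
      ∫ t in (z - z⁻¹)..z, Real.exp (t ^ 2) := by
    refine intervalIntegral.integral_mono_on (by linarith) (by simp)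
      (hcont.intervalIntegrable _ _) fun t ht => Real.exp_le_exp.2 ?_
    nlinarith [ht.1, mul_self_nonneg z⁻¹]
  rw [intervalIntegral.integral_const, smul_eq_mul, sub_sub_cancel] at hconst
  calc Real.exp (-2) * z⁻¹ = Real.exp (-z ^ 2) * (z⁻¹ * Real.exp (z ^ 2 - 2)) := by
        rw [mul_left_comm, ← Real.exp_add, mul_comm]
        ring_nf
    _ ≤ dawson z := mul_le_mul_of_nonneg_left (hconst.trans hsub) (Real.exp_pos _).le

/-- A positive multiple of `1 / u` has infinite mass near infinity. -/
lemma lintegral_Ioi_const_mul_inv_eq_top {a c : ℝ} (ha : 0 < a) (hc : 0 < c) :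
    ∫⁻ u in Ioi a, ENNReal.ofReal (c * u⁻¹) = ⊤ := by
  by_contra h
  have hint : IntegrableOn (fun u : ℝ => c * u⁻¹) (Ioi a) := by
    refine (lintegral_ofReal_ne_top_iff_integrable (by fun_prop) ?_).1 h
    filter_upwards [ae_restrict_mem measurableSet_Ioi] with u hu
    have : 0 < u := ha.trans hu
    positivity
  refine not_integrableOn_Ioi_inv (a := a) ?_
  refine (hint.const_mul c⁻¹).congr (Filter.Eventually.of_forall fun u => ?_)
  simp [hc.ne']

lemma lintegral_dawson_div_sqrt_two_eq_top :
    ∫⁻ u in Ioi (0:ℝ), ENNReal.ofReal (dawson (u / Real.sqrt 2)) = ⊤ := by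
  have h2 : 0 < Real.sqrt 2 := by positivity
  rw [eq_top_iff, ← lintegral_Ioi_const_mul_inv_eq_top h2
    (mul_pos (Real.exp_pos (-2)) h2)]
  refine (setLIntegral_mono' measurableSet_Ioi fun u hu => ENNReal.ofReal_le_ofReal ?_).trans
    (lintegral_mono_set (Ioi_subset_Ioi h2.le))
  have := exp_neg_two_mul_inv_le_dawson ((one_le_div h2).2 (le_of_lt hu))
  rwa [inv_div, div_eq_mul_inv, ← mul_assoc] at this

lemma integrableOn_horseshoe_mixture {τ x : ℝ} (hτ : 0 < τ) (hx : 0 < x) :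
    IntegrableOn (fun l : ℝ =>
      (Real.sqrt (2 * Real.pi))⁻¹ * (l * τ)⁻¹ * Real.exp (-x ^ 2 / (2 * l ^ 2 * τ ^ 2)) *
        ((2 / Real.pi) * (1 + l ^ 2)⁻¹)) (Ioi 0) := by
  refine Integrable.mono' (g := fun l : ℝ =>
    ((Real.sqrt (2 * Real.pi))⁻¹ * x⁻¹ * (2 / Real.pi)) * (1 + l ^ 2)⁻¹)
    (integrable_inv_one_add_sq.integrableOn.const_mul _)
    (Measurable.aestronglyMeasurable (by fun_prop)) ?_
  filter_upwards [ae_restrict_mem measurableSet_Ioi] with l hl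
  have hl : 0 < l := hl
  have key : (l * τ)⁻¹ * Real.exp (-x ^ 2 / (2 * l ^ 2 * τ ^ 2)) ≤ x⁻¹ := by
    set s := x / (l * τ) with hs
    have e1 : -x ^ 2 / (2 * l ^ 2 * τ ^ 2) = -(s ^ 2 / 2) := by
      rw [hs]; field_simp
    have e2 : (l * τ)⁻¹ = x⁻¹ * s := by
      rw [hs]; field_simp
    have hle : s ≤ Real.exp (s ^ 2 / 2) := by
      nlinarith [Real.add_one_le_exp (s ^ 2 / 2), sq_nonneg (s - 1)]
    rw [e1, e2, Real.exp_neg, mul_assoc, ← div_eq_mul_inv]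
    exact mul_le_of_le_one_right (by positivity) ((div_le_one (Real.exp_pos _)).2 hle)
  rw [Real.norm_of_nonneg (by positivity)]
  calc _ = (Real.sqrt (2 * Real.pi))⁻¹ * ((l * τ)⁻¹ *
        Real.exp (-x ^ 2 / (2 * l ^ 2 * τ ^ 2))) * ((2 / Real.pi) * (1 + l ^ 2)⁻¹) := by ring
    _ ≤ (Real.sqrt (2 * Real.pi))⁻¹ * x⁻¹ * ((2 / Real.pi) * (1 + l ^ 2)⁻¹) := by gcongr
    _ = _ := by ring

/-- The horseshoe density has at least a logarithmic pole at zero. -/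
lemma const_mul_log_le_pHS {τ x : ℝ} (hτ : 0 < τ) (hx : 0 < x) (hxτ : x < τ) :
    ((Real.sqrt (2 * Real.pi))⁻¹ * τ⁻¹ * Real.exp (-(1 / 2)) * ((2 / Real.pi) * 2⁻¹)) *
      Real.log (τ / x) ≤ pHS τ x := by
  have hd : 0 < x / τ := by positivity
  have hd1 : x / τ ≤ 1 := (div_le_one hτ).2 hxτ.le
  have hint := integrableOn_horseshoe_mixture hτ hx
  have hsub : Ioc (x / τ) 1 ⊆ Ioi 0 := fun l hl => hd.trans hl.1
  have hlog : ∫ l in Ioc (x / τ) 1, l⁻¹ = Real.log (τ / x) := by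
    rw [← intervalIntegral.integral_of_le hd1, integral_inv_of_pos hd one_pos, one_div_div]
  have hinv : IntegrableOn (fun l : ℝ => l⁻¹) (Ioc (x / τ) 1) := by
    rw [← intervalIntegrable_iff_integrableOn_Ioc_of_le hd1, intervalIntegrable_inv_iff]
    right
    rw [uIcc_of_le hd1]
    exact fun h => hd.not_ge h.1
  rw [← hlog, ← integral_const_mul]
  refine (setIntegral_mono_on (hinv.const_mul _) (hint.mono_set hsub) measurableSet_Ioc
    fun l hl => ?_).trans (setIntegral_mono_set hint ?_ (Filter.Eventually.of_forall hsub))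
  · have hl0 : 0 < l := hd.trans hl.1
    have hexp : Real.exp (-(1 / 2)) ≤ Real.exp (-x ^ 2 / (2 * l ^ 2 * τ ^ 2)) := by
      have hxl : x ≤ l * τ := ((div_lt_iff₀ hτ).1 hl.1).le
      rw [Real.exp_le_exp, neg_div, neg_le_neg_iff, div_le_div_iff₀ (by positivity) two_pos]
      nlinarith [mul_self_le_mul_self hx.le hxl]
    have hcauchy : (2:ℝ)⁻¹ ≤ (1 + l ^ 2)⁻¹ := by
      gcongr
      nlinarith [hl.2]
    calc _ = (Real.sqrt (2 * Real.pi))⁻¹ * (l * τ)⁻¹ * Real.exp (-(1 / 2)) *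
          ((2 / Real.pi) * 2⁻¹) := by rw [mul_inv]; ring
      _ ≤ _ := by gcongr
  · filter_upwards [ae_restrict_mem measurableSet_Ioi] with l hl
    have hl : 0 < l := hl
    simp only [Pi.zero_apply]
    positivity

lemma tendsto_pHS_atTop {τ : ℝ} (hτ : 0 < τ) :
    Filter.Tendsto (pHS τ) (nhdsWithin 0 (Ioi 0)) Filter.atTop := by
  have hlog : Filter.Tendsto (fun x : ℝ => Real.log (τ / x)) (nhdsWithin 0 (Ioi 0))
      Filter.atTop :=
    Real.tendsto_log_atTop.comp (tendsto_inv_nhdsGT_zero.const_mul_atTop hτ)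
  refine Filter.tendsto_atTop_mono' _ ?_ (hlog.const_mul_atTop
    (r := (Real.sqrt (2 * Real.pi))⁻¹ * τ⁻¹ * Real.exp (-(1 / 2)) * ((2 / Real.pi) * 2⁻¹))
    (by positivity))
  filter_upwards [Ioo_mem_nhdsGT hτ] with x hx
  exact const_mul_log_le_pHS hτ hx.1 hx.2

/-- The Dawson-weighted exponential kernel has infinite mass on `(0,∞)`, and consequently
the horseshoe density is unbounded at zero. -/
theorem dawson_kernel_infinite_mass_horseshoe_unbounded :
    (∫⁻ u in Ioi (0:ℝ), ENNReal.ofReal (dawson (u / Real.sqrt 2))) = ⊤ ∧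
    ∀ τ : ℝ, 0 < τ → Filter.Tendsto (pHS τ) (nhdsWithin 0 (Ioi 0)) Filter.atTop :=
  ⟨lintegral_dawson_div_sqrt_two_eq_top, fun _ hτ => tendsto_pHS_atTop hτ⟩
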